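/- arXiv:2503.03388 — 5 statements merged into one kernel-verified Lean document; each statement's English description precedes it below -/
import Mathlib

section
/- Corollary 3.5. Let the hypotheses of Theorem 3.1 (respectively Theorem 3.2) hold and let x(·) be a solution of (PS) provided by that theorem for a symbol sequence e, with shifts α_j. Set c̃ = 2·sup{‖γ̇(t)‖ : t ∈ ℝ}. (i) If in addition case (a) holds (r ≥ 2 and |M′(T_{2j})| > C > 0 for all j, so that |α_j| ≤ c_α·ε), then for every j with e_j = 1 one has ‖x(t) − γ(t − T_{2j})‖ ≤ c̃*·ε for all t ∈ [T_{2j−1}, T_{2j+1}], where c̃* = c* + c̃·c_α. (ii) If instead case (b) holds (isolated zeros with modulus ω_M, so that |α_j| ≤ ω_α(ε)), then for every j with e_j = 1 one has ‖x(t) − γ(t − T_{2j})‖ ≤ c*·ε + c̃·ω_α(ε) for all t ∈ [T_{2j−1}, T_{2j+1}]. In both cases the shift α_j has been eliminated from the estimate, using that ‖γ(t+α) − γ(t)‖ ≤ c̃·|α| for all t ∈ ℝ and all α. -/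
open Set Filter MeasureTheory RealInnerProductSpace Bornology Topology

noncomputable section

abbrev ℝ2 : Type := EuclideanSpace ℝ (Fin 2)

/-- The planar wedge product `a ∧ b = a₁b₂ − a₂b₁`. -/
def wedge (a b : ℝ2) : ℝ := a 0 * b 1 - a 1 * b 0

/-- The data of the planar piecewise-smooth system (PS):
`ẋ = f±(x) + ε g(t,x,ε)` on `Ω± = {±G > 0}`. -/
structure PSSystem where
  Ω : Set ℝ2
  G : ℝ2 → ℝ
  fp : ℝ2 → ℝ2
  fm : ℝ2 → ℝ2
  g : ℝ → ℝ2 → ℝ → ℝ2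

namespace PSSystem

variable (S : PSSystem)

def Ωp : Set ℝ2 := {x ∈ S.Ω | 0 < S.G x}
def Ωm : Set ℝ2 := {x ∈ S.Ω | S.G x < 0}
def Ω0 : Set ℝ2 := {x ∈ S.Ω | S.G x = 0}

/-- `x` is a solution of (PS) with parameter `ε` on the time set `I`:
it is continuous and solves the appropriate equation whenever it is in `Ω⁺` or `Ω⁻`
(sliding solutions are excluded). -/
def IsSolOn (ε : ℝ) (x : ℝ → ℝ2) (I : Set ℝ) : Prop :=
  ContinuousOn x I ∧
  (∀ t ∈ I, x t ∈ S.Ωp → HasDerivAt x (S.fp (x t) + ε • S.g t (x t) ε) t) ∧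
  (∀ t ∈ I, x t ∈ S.Ωm → HasDerivAt x (S.fm (x t) + ε • S.g t (x t) ε) t)

/-- The (global) stable set at time `τ`. -/
def Wstable (ε τ : ℝ) : Set ℝ2 :=
  {ξ | ∃ x : ℝ → ℝ2, x τ = ξ ∧ S.IsSolOn ε x (Ici τ) ∧ Tendsto x atTop (nhds 0)}

/-- The (global) unstable set at time `τ`. -/
def Wunstable (ε τ : ℝ) : Set ℝ2 :=
  {ξ | ∃ x : ℝ → ℝ2, x τ = ξ ∧ S.IsSolOn ε x (Iic τ) ∧ Tendsto x atBot (nhds 0)}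

end PSSystem

/-- `Γ = {γ(t) : t ∈ ℝ} ∪ {0}`. -/
def Γset (γ : ℝ → ℝ2) : Set ℝ2 := Set.range γ ∪ {0}

/-- The polyline `𝒯ᵘ = {c u : c ≥ 0} ∪ {c v : c ≥ 0}`. -/
def polyline (u v : ℝ2) : Set ℝ2 := {x | ∃ c : ℝ, 0 ≤ c ∧ (x = c • u ∨ x = c • v)}

def cperpP (S : PSSystem) (γ : ℝ → ℝ2) : ℝ :=
  ‖gradient S.G (γ 0)‖ / ⟪gradient S.G (γ 0), S.fp (γ 0)⟫

def cperpM (S : PSSystem) (γ : ℝ → ℝ2) : ℝ :=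
  ‖gradient S.G (γ 0)‖ / ⟪gradient S.G (γ 0), S.fm (γ 0)⟫

/-- The Melnikov function of the piecewise-smooth planar system along the homoclinic `γ`. -/
def Melnikov (S : PSSystem) (γ : ℝ → ℝ2) (α : ℝ) : ℝ :=
  cperpM S γ *
    ∫ t in Set.Iic (0:ℝ),
      Real.exp (-(∫ s in (0:ℝ)..t,
          LinearMap.trace ℝ ℝ2 (fderiv ℝ S.fm (γ s) : ℝ2 →ₗ[ℝ] ℝ2))) *
        wedge (S.fm (γ t)) (S.g (t + α) (γ t) 0) +
  cperpP S γ *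
    ∫ t in Set.Ici (0:ℝ),
      Real.exp (-(∫ s in (0:ℝ)..t,
          LinearMap.trace ℝ ℝ2 (fderiv ℝ S.fp (γ s) : ℝ2 →ₗ[ℝ] ℝ2))) *
        wedge (S.fp (γ t)) (S.g (t + α) (γ t) 0)

/-- The standing hypotheses (F0), (F1), (F2), (K), Scenario 1, (G), (P1) for the
piecewise-smooth planar system (PS). -/
structure Standing where
  S : PSSystem
  /-- smoothness degree `r > 1` -/
  r : ℝ
  hr : 1 < r
  hΩ_open : IsOpen S.Ω
  hG_smooth : ContDiffOn ℝ 1 S.G S.Ω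
  /-- `0` is a regular value of `G` -/
  hG_reg : ∀ x ∈ S.Ω, S.G x = 0 → gradient S.G x ≠ 0
  hfp_smooth : ContDiffOn ℝ 1 S.fp (S.Ωp ∪ S.Ω0)
  hfm_smooth : ContDiffOn ℝ 1 S.fm (S.Ωm ∪ S.Ω0)
  hfp_bdd : ∃ C : ℝ, ∀ x ∈ S.Ωp ∪ S.Ω0, ‖S.fp x‖ ≤ C
  hfm_bdd : ∃ C : ℝ, ∀ x ∈ S.Ωm ∪ S.Ω0, ‖S.fm x‖ ≤ C
  hg_smooth : ContDiff ℝ 1 fun p : ℝ × ℝ2 × ℝ => S.g p.1 p.2.1 p.2.2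
  -- (F0)
  lsp : ℝ
  lup : ℝ
  lsm : ℝ
  lum : ℝ
  vsp : ℝ2
  vup : ℝ2
  vsm : ℝ2
  vum : ℝ2
  h0mem : (0:ℝ2) ∈ S.Ω0
  hfp0 : S.fp 0 = 0
  hfm0 : S.fm 0 = 0
  hlsp : lsp < 0
  hlup : 0 < lup
  hlsm : lsm < 0
  hlum : 0 < lum
  hvsp_unit : ‖vsp‖ = 1
  hvup_unit : ‖vup‖ = 1
  hvsm_unit : ‖vsm‖ = 1
  hvum_unit : ‖vum‖ = 1
  hvsp_eig : fderiv ℝ S.fp 0 vsp = lsp • vsp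
  hvup_eig : fderiv ℝ S.fp 0 vup = lup • vup
  hvsm_eig : fderiv ℝ S.fm 0 vsm = lsm • vsm
  hvum_eig : fderiv ℝ S.fm 0 vum = lum • vum
  -- (F1)
  hF1um : ⟪gradient S.G 0, vum⟫ < 0
  hF1up : 0 < ⟪gradient S.G 0, vup⟫
  hF1sm : ⟪gradient S.G 0, vsm⟫ < 0
  hF1sp : 0 < ⟪gradient S.G 0, vsp⟫
  -- (F2): `vs⁺` and `vs⁻` lie in different components of the complement of the polyline
  hF2sp : vsp ∉ polyline vup vum
  hF2sm : vsm ∉ polyline vup vum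
  hF2 : connectedComponentIn (polyline vup vum)ᶜ vsp ≠
        connectedComponentIn (polyline vup vum)ᶜ vsm
  -- (K): the homoclinic trajectory
  γ : ℝ → ℝ2
  hγ_sol : S.IsSolOn 0 γ Set.univ
  hγ_minus : ∀ t : ℝ, t < 0 → γ t ∈ S.Ωm
  hγ_zero : γ 0 ∈ S.Ω0
  hγ_plus : ∀ t : ℝ, 0 < t → γ t ∈ S.Ωp
  hγ_top : Tendsto γ atTop (nhds 0)
  hγ_bot : Tendsto γ atBot (nhds 0)
  hγ_ne : ∀ t : ℝ, γ t ≠ 0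
  hK_trans_p : 0 < ⟪gradient S.G (γ 0), S.fp (γ 0)⟫
  hK_trans_m : 0 < ⟪gradient S.G (γ 0), S.fm (γ 0)⟫
  hγ_uniq : ∀ γ' : ℝ → ℝ2, S.IsSolOn 0 γ' Set.univ → (∀ t : ℝ, t < 0 → γ' t ∈ S.Ωm) →
    γ' 0 ∈ S.Ω0 → (∀ t : ℝ, 0 < t → γ' t ∈ S.Ωp) →
    Tendsto γ' atTop (nhds 0) → Tendsto γ' atBot (nhds 0) → γ' = γ
  hdir_bot : Tendsto (fun t => ‖S.fm (γ t)‖⁻¹ • S.fm (γ t)) atBot (nhds vum)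
  hdir_top : Tendsto (fun t => ‖S.fp (γ t)‖⁻¹ • S.fp (γ t)) atTop (nhds (-vsp))
  -- Scenario 1: `d vu⁺` and `d vs⁻` lie in the unbounded component of `Γᶜ`
  hScen1 : ∃ ρ : ℝ, 0 < ρ ∧ ∀ d : ℝ, 0 < d → d < ρ →
    (d • vup ∈ (Γset γ)ᶜ ∧ ¬ IsBounded (connectedComponentIn (Γset γ)ᶜ (d • vup))) ∧
    (d • vsm ∈ (Γset γ)ᶜ ∧ ¬ IsBounded (connectedComponentIn (Γset γ)ᶜ (d • vsm)))
  -- (G)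
  hg_bdd : ∃ Cg : ℝ, ∀ t ε' : ℝ, 0 ≤ ε' → ∀ x ∈ Metric.thickening 1 (Γset γ),
    ‖S.g t x ε'‖ ≤ Cg
  hg_zero : ∀ t ε' : ℝ, S.g t 0 ε' = 0
  -- (P1)
  cbar : ℝ
  hcbar : 0 < cbar
  b : ℤ → ℝ
  hb_mono : StrictMono b
  hb_gap : ∀ i : ℤ, 1/10 ≤ b (i+1) - b i
  hb_neg : ∀ i : ℤ, Melnikov S γ (b (2*i)) < -cbar
  hb_pos : ∀ i : ℤ, cbar < Melnikov S γ (b (2*i+1))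

namespace Standing

variable (H : Standing)

def σfp : ℝ := |H.lsp| / (H.lup + |H.lsp|)
def σfm : ℝ := (H.lum + |H.lsm|) / H.lum
def σfwd : ℝ := H.σfp * H.σfm
def σbm : ℝ := 1 / H.σfm
def σlow : ℝ := min H.σfp H.σbm
def σhigh : ℝ := max H.σfp H.σbm
def Sfwd : ℝ := (H.lum + |H.lsp|) / (H.lum * (H.lup + |H.lsp|))
def Sbwd : ℝ := (H.lum + |H.lsp|) / (|H.lsp| * (H.lum + |H.lsm|))
def Shigh : ℝ := max H.Sfwd H.Sbwd
def K0 : ℝ := 3 * H.Shigh / (2 * H.σlow)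
def ν0 : ℝ := max (3 * H.σhigh - 1) 1
def M : ℝ → ℝ := Melnikov H.S H.γ
/-- `c̃ = 2 sup {‖γ̇⁺(t)‖, ‖γ̇⁻(s)‖ : s < 0 < t}` (recall `γ̇ = f±(γ)`). -/
def ctilde : ℝ :=
  2 * sSup (((fun t => ‖H.S.fp (H.γ t)‖) '' Set.Ioi 0) ∪
            ((fun t => ‖H.S.fm (H.γ t)‖) '' Set.Iio 0))

end Standing

/-- Condition (min) for a forward sequence `T = (T_j)_{j ≥ 1}`, with windows
`[a↑_j, a↓_j] ⊂ (β_{2j}, β'_{2j})`, where `β_{2j} = b n < T_{2j} < b (n+1) = β'_{2j}` are the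
consecutive terms of `b` surrounding `T_{2j}`. -/
def CondMin (M : ℝ → ℝ) (b : ℤ → ℝ) (cbar δ Λ0 Λ1 : ℝ) (T aup adown : ℕ → ℝ) : Prop :=
  ∀ j : ℕ, 1 ≤ j → ∃ n : ℤ,
    b n < T (2*j) ∧ T (2*j) < b (n+1) ∧
    b n < aup j ∧ aup j < T (2*j) - Λ0 ∧ T (2*j) + Λ0 < adown j ∧ adown j < b (n+1) ∧
    |M (aup j)| = δ * cbar ∧ |M (adown j)| = δ * cbar ∧ M (aup j) * M (adown j) < 0 ∧
    (∀ s ∈ Set.Icc (aup j) (adown j),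
      s ∉ Set.Icc (T (2*j) - Λ0) (T (2*j) + Λ0) → M s ≠ 0) ∧
    adown j - aup j ≤ Λ1

/-- Condition (min) for a backward sequence `T = (T_j)_{j ≤ -1}`. -/
def CondMinNeg (M : ℝ → ℝ) (b : ℤ → ℝ) (cbar δ Λ0 Λ1 : ℝ) (T aup adown : ℤ → ℝ) : Prop :=
  ∀ j : ℤ, j ≤ -1 → ∃ n : ℤ,
    b n < T (2*j) ∧ T (2*j) < b (n+1) ∧
    b n < aup j ∧ aup j < T (2*j) - Λ0 ∧ T (2*j) + Λ0 < adown j ∧ adown j < b (n+1) ∧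
    |M (aup j)| = δ * cbar ∧ |M (adown j)| = δ * cbar ∧ M (aup j) * M (adown j) < 0 ∧
    (∀ s ∈ Set.Icc (aup j) (adown j),
      s ∉ Set.Icc (T (2*j) - Λ0) (T (2*j) + Λ0) → M s ≠ 0) ∧
    adown j - aup j ≤ Λ1

/-- Property `C⁺ₑ` for a solution `x` of (PS): near `γ(· - τ)` on `[τ, T₁]` and, on each
window `[T_{2j-1}, T_{2j+1}]`, near a shifted copy of `γ` if `e_j = 1` and near the origin
if `e_j = 0`. -/
def PropCplus (γ : ℝ → ℝ2) (ε τ cstar : ℝ) (T α : ℕ → ℝ) (e : ℕ → Bool) (x : ℝ → ℝ2) : Prop :=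
  (∀ t ∈ Set.Icc τ (T 1), ‖x t - γ (t - τ)‖ ≤ cstar * ε) ∧
  ∀ j : ℕ, 1 ≤ j →
    (e j = true → ∀ t ∈ Set.Icc (T (2*j-1)) (T (2*j+1)),
      ‖x t - γ (t - T (2*j) - α j)‖ ≤ cstar * ε) ∧
    (e j = false → ∀ t ∈ Set.Icc (T (2*j-1)) (T (2*j+1)), ‖x t‖ ≤ cstar * ε)

/-- Property `C⁻ₑ` for a solution `x` of (PS) (backward time). -/
def PropCminus (γ : ℝ → ℝ2) (ε τ cstar : ℝ) (T α : ℤ → ℝ) (e : ℤ → Bool) (x : ℝ → ℝ2) : Prop :=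
  (∀ t ∈ Set.Icc (T (-1)) τ, ‖x t - γ (t - τ)‖ ≤ cstar * ε) ∧
  ∀ j : ℤ, j ≤ -1 →
    (e j = true → ∀ t ∈ Set.Icc (T (2*j-1)) (T (2*j+1)),
      ‖x t - γ (t - T (2*j) - α j)‖ ≤ cstar * ε) ∧
    (e j = false → ∀ t ∈ Set.Icc (T (2*j-1)) (T (2*j+1)), ‖x t‖ ≤ cstar * ε)

/-- `P` is an endpoint of `A ⊆ Ω⁰` with respect to the arclength ordering along `Ω⁰`:
for every injective continuous arc in `Ω⁰` covering `A`, the parameter of `P` is extremal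
among the parameters of the points of `A`. -/
def IsCurveEndpoint (A Ω0 : Set ℝ2) (P : ℝ2) : Prop :=
  ∀ ϕ : ℝ → ℝ2, ContinuousOn ϕ (Set.Icc 0 1) → Set.InjOn ϕ (Set.Icc 0 1) →
    ϕ '' Set.Icc 0 1 ⊆ Ω0 → A ⊆ ϕ '' Set.Icc 0 1 →
    ∀ s ∈ Set.Icc (0:ℝ) 1, ϕ s = P →
      (∀ u ∈ Set.Icc (0:ℝ) 1, ϕ u ∈ A → s ≤ u) ∨ (∀ u ∈ Set.Icc (0:ℝ) 1, ϕ u ∈ A → u ≤ s)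

/-- `C` is the branch `W̃ˢ(t)` of the stable set joining the origin to its intersection
point with `Ω⁰` near `γ(0)`. -/
def IsStableBranch (S : PSSystem) (γ0 : ℝ2) (ε t : ℝ) (C : Set ℝ2) : Prop :=
  IsCompact C ∧ IsConnected C ∧ (0:ℝ2) ∈ C ∧ C ⊆ S.Wstable ε t ∧
  ∃ P ∈ C, P ∈ S.Ω0 ∧ ‖P - γ0‖ ≤ Real.sqrt ε

/-- `C` is the branch `W̃ᵘ(t)` of the unstable set joining the origin to its intersection
point with `Ω⁰` near `γ(0)`. -/
def IsUnstableBranch (S : PSSystem) (γ0 : ℝ2) (ε t : ℝ) (C : Set ℝ2) : Prop :=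
  IsCompact C ∧ IsConnected C ∧ (0:ℝ2) ∈ C ∧ C ⊆ S.Wunstable ε t ∧
  ∃ P ∈ C, P ∈ S.Ω0 ∧ ‖P - γ0‖ ≤ Real.sqrt ε

theorem lipschitzWith_of_Iic_of_Ici {E : Type*} [PseudoMetricSpace E] {f : ℝ → E} {K : NNReal}
    {c : ℝ} (hl : LipschitzOnWith K f (Set.Iic c)) (hr : LipschitzOnWith K f (Set.Ici c)) :
    LipschitzWith K f := by
  have key : ∀ s t : ℝ, s ≤ t → dist (f s) (f t) ≤ K * dist s t := by
    intro s t hst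
    rcases le_total t c with htc | hct
    · exact hl.dist_le_mul s (hst.trans htc) t htc
    rcases le_total c s with hcs | hsc
    · exact hr.dist_le_mul s hcs t hct
    calc dist (f s) (f t) ≤ dist (f s) (f c) + dist (f c) (f t) := dist_triangle _ _ _
      _ ≤ K * dist s c + K * dist c t :=
          add_le_add (hl.dist_le_mul s hsc c Set.self_mem_Iic) (hr.dist_le_mul c Set.self_mem_Ici t hct)
      _ = K * dist s t := by
          rw [← mul_add, Real.dist_eq, Real.dist_eq, Real.dist_eq, abs_of_nonpos (by linarith),
            abs_of_nonpos (by linarith), abs_of_nonpos (by linarith)]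
          ring
  refine LipschitzWith.of_dist_le_mul fun s t => ?_
  rcases le_total s t with h | h
  · exact key s t h
  · rw [dist_comm (f s), dist_comm s]
    exact key t s h

namespace Standing

variable (H : Standing)

theorem bddAbove_speeds :
    BddAbove (((fun t => ‖H.S.fp (H.γ t)‖) '' Set.Ioi 0) ∪
      ((fun t => ‖H.S.fm (H.γ t)‖) '' Set.Iio 0)) := by
  obtain ⟨Cp, hp⟩ := H.hfp_bdd
  obtain ⟨Cm, hm⟩ := H.hfm_bdd
  refine BddAbove.union ⟨Cp, ?_⟩ ⟨Cm, ?_⟩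
  · rintro _ ⟨t, ht, rfl⟩
    exact hp _ (Or.inl (H.hγ_plus t ht))
  · rintro _ ⟨t, ht, rfl⟩
    exact hm _ (Or.inl (H.hγ_minus t ht))

theorem norm_fp_le {t : ℝ} (ht : 0 < t) : ‖H.S.fp (H.γ t)‖ ≤ H.ctilde / 2 := by
  have := le_csSup H.bddAbove_speeds (Or.inl (Set.mem_image_of_mem _ (Set.mem_Ioi.2 ht)))
  rw [ctilde]
  linarith

theorem norm_fm_le {t : ℝ} (ht : t < 0) : ‖H.S.fm (H.γ t)‖ ≤ H.ctilde / 2 := by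
  have := le_csSup H.bddAbove_speeds (Or.inr (Set.mem_image_of_mem _ (Set.mem_Iio.2 ht)))
  rw [ctilde]
  linarith

theorem ctilde_nonneg : 0 ≤ H.ctilde := by
  linarith [norm_nonneg (H.S.fp (H.γ 1)), H.norm_fp_le one_pos]

theorem lipschitzWith_homoclinic : LipschitzWith (H.ctilde / 2).toNNReal H.γ := by
  obtain ⟨hc, hp, hm⟩ := H.hγ_sol
  have hc' : Continuous H.γ := continuousOn_univ.1 hc
  apply lipschitzWith_of_Iic_of_Ici (c := 0)
  · have h : LipschitzOnWith (H.ctilde / 2).toNNReal H.γ (Set.Iio 0) := by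
      refine (convex_Iio 0).lipschitzOnWith_of_nnnorm_hasDerivWithin_le
        (fun t ht => (hm t (Set.mem_univ t) (H.hγ_minus t ht)).hasDerivWithinAt) fun t ht => ?_
      rw [zero_smul, add_zero]
      exact NNReal.le_toNNReal_of_coe_le (H.norm_fm_le ht)
    simpa using h.closure hc'.continuousOn
  · have h : LipschitzOnWith (H.ctilde / 2).toNNReal H.γ (Set.Ioi 0) := by
      refine (convex_Ioi 0).lipschitzOnWith_of_nnnorm_hasDerivWithin_le
        (fun t ht => (hp t (Set.mem_univ t) (H.hγ_plus t ht)).hasDerivWithinAt) fun t ht => ?_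
      rw [zero_smul, add_zero]
      exact NNReal.le_toNNReal_of_coe_le (H.norm_fp_le ht)
    simpa using h.closure hc'.continuousOn

theorem norm_homoclinic_sub_le (s a : ℝ) : ‖H.γ (s - a) - H.γ s‖ ≤ H.ctilde * |a| := by
  have h := H.lipschitzWith_homoclinic.dist_le_mul (s - a) s
  have h0 := H.ctilde_nonneg
  rw [dist_eq_norm, Real.coe_toNNReal _ (by linarith), Real.dist_eq, sub_sub_cancel_left,
    abs_neg] at h
  nlinarith [mul_nonneg h0 (abs_nonneg a)]

theorem norm_sub_homoclinic_le {y : ℝ2} {s a A B : ℝ} (h : ‖y - H.γ (s - a)‖ ≤ A)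
    (ha : |a| ≤ B) : ‖y - H.γ s‖ ≤ A + H.ctilde * B :=
  (norm_sub_le_norm_sub_add_norm_sub y (H.γ (s - a)) (H.γ s)).trans <|
    add_le_add h <| (H.norm_homoclinic_sub_le s a).trans <|
      mul_le_mul_of_nonneg_left ha H.ctilde_nonneg

end Standing

/-- **Corollary 3.5.**
Let the standing hypotheses of Theorems 3.1/3.2 hold and let `x` be a solution furnished
by those theorems for a symbol sequence `e` with shifts `α_j` (so `x` satisfies `C⁺ₑ`,
resp. `C⁻ₑ`).  With `c̃ = 2 sup ‖γ̇‖`: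
(i) if `|α_j| ≤ c_α ε` (case (a)) then for every `j` with `e_j = 1`,
`‖x(t) − γ(t − T_{2j})‖ ≤ (c* + c̃ c_α) ε` on `[T_{2j-1}, T_{2j+1}]`;
(ii) if `|α_j| ≤ ω_α(ε)` (case (b)) then `‖x(t) − γ(t − T_{2j})‖ ≤ c* ε + c̃ ω_α(ε)` there.
The same holds for the backward-time solutions of Theorem 3.2. -/
theorem corollary_3_5 (H : Standing) :
    -- forward time, case (a)
    (∀ ε cstar cα : ℝ, 0 < ε → 0 < cstar → 0 < cα →
      ∀ τ : ℝ, ∀ T α : ℕ → ℝ, ∀ e : ℕ → Bool, ∀ x : ℝ → ℝ2,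
        H.S.IsSolOn ε x (Set.Ici τ) → PropCplus H.γ ε τ cstar T α e x →
        (∀ j : ℕ, 1 ≤ j → |α j| ≤ cα * ε) →
        ∀ j : ℕ, 1 ≤ j → e j = true →
          ∀ t ∈ Set.Icc (T (2*j-1)) (T (2*j+1)),
            ‖x t - H.γ (t - T (2*j))‖ ≤ (cstar + H.ctilde * cα) * ε) ∧
    -- forward time, case (b)
    (∀ ε cstar : ℝ, ∀ ωα : ℝ → ℝ, 0 < ε → 0 < cstar →
      ∀ τ : ℝ, ∀ T α : ℕ → ℝ, ∀ e : ℕ → Bool, ∀ x : ℝ → ℝ2,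
        H.S.IsSolOn ε x (Set.Ici τ) → PropCplus H.γ ε τ cstar T α e x →
        (∀ j : ℕ, 1 ≤ j → |α j| ≤ ωα ε) →
        ∀ j : ℕ, 1 ≤ j → e j = true →
          ∀ t ∈ Set.Icc (T (2*j-1)) (T (2*j+1)),
            ‖x t - H.γ (t - T (2*j))‖ ≤ cstar * ε + H.ctilde * ωα ε) ∧
    -- backward time, case (a)
    (∀ ε cstar cα : ℝ, 0 < ε → 0 < cstar → 0 < cα →
      ∀ τ : ℝ, ∀ T α : ℤ → ℝ, ∀ e : ℤ → Bool, ∀ x : ℝ → ℝ2,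
        H.S.IsSolOn ε x (Set.Iic τ) → PropCminus H.γ ε τ cstar T α e x →
        (∀ j : ℤ, j ≤ -1 → |α j| ≤ cα * ε) →
        ∀ j : ℤ, j ≤ -1 → e j = true →
          ∀ t ∈ Set.Icc (T (2*j-1)) (T (2*j+1)),
            ‖x t - H.γ (t - T (2*j))‖ ≤ (cstar + H.ctilde * cα) * ε) ∧
    -- backward time, case (b)
    (∀ ε cstar : ℝ, ∀ ωα : ℝ → ℝ, 0 < ε → 0 < cstar →
      ∀ τ : ℝ, ∀ T α : ℤ → ℝ, ∀ e : ℤ → Bool, ∀ x : ℝ → ℝ2,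
        H.S.IsSolOn ε x (Set.Iic τ) → PropCminus H.γ ε τ cstar T α e x →
        (∀ j : ℤ, j ≤ -1 → |α j| ≤ ωα ε) →
        ∀ j : ℤ, j ≤ -1 → e j = true →
          ∀ t ∈ Set.Icc (T (2*j-1)) (T (2*j+1)),
            ‖x t - H.γ (t - T (2*j))‖ ≤ cstar * ε + H.ctilde * ωα ε) := by
  refine ⟨?_, ?_, ?_, ?_⟩
  · intro ε cstar cα _ _ _ τ T α e x _ hC hα j hj he t ht
    have h := H.norm_sub_homoclinic_le ((hC.2 j hj).1 he t ht) (hα j hj)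
    linarith
  · intro ε cstar ωα _ _ τ T α e x _ hC hα j hj he t ht
    exact H.norm_sub_homoclinic_le ((hC.2 j hj).1 he t ht) (hα j hj)
  · intro ε cstar cα _ _ _ τ T α e x _ hC hα j hj he t ht
    have h := H.norm_sub_homoclinic_le ((hC.2 j hj).1 he t ht) (hα j hj)
    linarith
  · intro ε cstar ωα _ _ τ T α e x _ hC hα j hj he t ht
    exact H.norm_sub_homoclinic_le ((hC.2 j hj).1 he t ht) (hα j hj)
end
end

section
/- Remark 3.4 (distinct symbol sequences give disjoint chaotic sets). Assume the setting and hypotheses of Theorem 3.1, with fixed ν ≥ ν₀, τ ∈ [b₀,b₁] and sequence T⁺. There exists ε₀ > 0, depending only on c*, Λ¹ and γ, such that for every 0 < ε ≤ ε₀ the following holds: if ê, ě ∈ {0,1}^{ℤ⁺} are two distinct sequences, then no solution x(·) of (PS) can simultaneously satisfy property C⁺_ê (with some shifts |α_j| ≤ Λ¹) and property C⁺_ě (with some shifts |α′_j| ≤ Λ¹). Consequently X⁺(ê,τ,T⁺) ∩ X⁺(ě,τ,T⁺) = ∅. The analogous disjointness holds for the sets X⁻ of Theorem 3.2. -/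
open Set Filter MeasureTheory RealInnerProductSpace Bornology Topology

noncomputable section

/-- A continuous nowhere vanishing curve is uniformly bounded away from `0` on compact
symmetric intervals. -/
theorem exists_pos_lt_norm_of_abs_le {γ : ℝ → ℝ2} (hγ : Continuous γ) (hne : ∀ t, γ t ≠ 0)
    {Λ : ℝ} (hΛ : 0 ≤ Λ) : ∃ m > 0, ∀ s, |s| ≤ Λ → m < ‖γ s‖ := by
  obtain ⟨s₀, -, hmin⟩ := (isCompact_Icc (a := -Λ) (b := Λ)).exists_isMinOn
    ⟨0, by constructor <;> linarith⟩ hγ.norm.continuousOn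
  have hpos : 0 < ‖γ s₀‖ := norm_pos_iff.mpr (hne s₀)
  refine ⟨‖γ s₀‖ / 2, half_pos hpos, fun s hs => ?_⟩
  have : ‖γ s₀‖ ≤ ‖γ s‖ := hmin (abs_le.mp hs)
  linarith

/-- At the centre of a window, a curve cannot be close both to a shifted copy of `γ`
and to the origin, if `γ` stays far from the origin at the times `|s| ≤ Λ`. -/
theorem not_near_shift_and_near_zero {γ x : ℝ → ℝ2} {Λ m δ a t₀ b α : ℝ}
    (hm : ∀ s, |s| ≤ Λ → m < ‖γ s‖) (hδ : 2 * δ ≤ m) (hα : |α| ≤ Λ) (ht₀ : t₀ ∈ Icc a b)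
    (hshift : ∀ t ∈ Icc a b, ‖x t - γ (t - t₀ - α)‖ ≤ δ)
    (hzero : ∀ t ∈ Icc a b, ‖x t‖ ≤ δ) : False := by
  have h₁ := hshift t₀ ht₀
  have h₂ := hzero t₀ ht₀
  rw [sub_self, zero_sub] at h₁
  have h₃ := hm (-α) (by rwa [abs_neg])
  have h₄ := norm_sub_norm_le (γ (-α)) (x t₀)
  rw [norm_sub_rev] at h₄
  linarith

/-- **Remark 3.4 (distinct symbol sequences give disjoint chaotic sets).**
Under the standing hypotheses, there is `ε₀ > 0` (depending only on `c*`, `Λ¹` and `γ`)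
such that for `0 < ε ≤ ε₀` no solution of (PS) can satisfy property `C⁺` simultaneously
for two distinct symbol sequences (with any admissible shifts `|α_j| ≤ Λ¹`); consequently
the sets `X⁺(ê,τ,T⁺)` and `X⁺(ě,τ,T⁺)` of Theorem 3.1 are disjoint for `ê ≠ ě`.  The
analogous statement holds in backward time for the sets `X⁻` of Theorem 3.2. -/
theorem remark_3_4
    (H : Standing) (Λ1 cstar : ℝ) (hΛ1 : 0 < Λ1) (hc : 0 < cstar) :
    ∃ ε0 > (0:ℝ), ∀ ε : ℝ, 0 < ε → ε ≤ ε0 →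
      -- forward time
      ((∀ τ : ℝ, ∀ T : ℕ → ℝ, MonotoneOn T {j : ℕ | 1 ≤ j} →
        ∀ ehat echk : ℕ → Bool, (∃ j : ℕ, 1 ≤ j ∧ ehat j ≠ echk j) →
        ∀ αhat αchk : ℕ → ℝ,
          (∀ j : ℕ, 1 ≤ j → |αhat j| ≤ Λ1) → (∀ j : ℕ, 1 ≤ j → |αchk j| ≤ Λ1) →
        ∀ x : ℝ → ℝ2,
          ¬(PropCplus H.γ ε τ cstar T αhat ehat x ∧
            PropCplus H.γ ε τ cstar T αchk echk x)) ∧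
      -- backward time
      (∀ τ : ℝ, ∀ T : ℤ → ℝ, MonotoneOn T {j : ℤ | j ≤ -1} →
        ∀ ehat echk : ℤ → Bool, (∃ j : ℤ, j ≤ -1 ∧ ehat j ≠ echk j) →
        ∀ αhat αchk : ℤ → ℝ,
          (∀ j : ℤ, j ≤ -1 → |αhat j| ≤ Λ1) → (∀ j : ℤ, j ≤ -1 → |αchk j| ≤ Λ1) →
        ∀ x : ℝ → ℝ2,
          ¬(PropCminus H.γ ε τ cstar T αhat ehat x ∧
            PropCminus H.γ ε τ cstar T αchk echk x))) := by
  obtain ⟨m, hm0, hm⟩ := exists_pos_lt_norm_of_abs_le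
    (continuousOn_univ.mp H.hγ_sol.1) H.hγ_ne hΛ1.le
  refine ⟨m / (2 * cstar), by positivity, fun ε _ hε => ?_⟩
  have hδ : 2 * (cstar * ε) ≤ m := by
    rw [le_div_iff₀ (by positivity)] at hε
    linarith
  constructor
  · rintro τ T hT ehat echk ⟨j, hj, hne⟩ αhat αchk hαhat hαchk x ⟨hhat, hchk⟩
    have hmem : T (2 * j) ∈ Icc (T (2 * j - 1)) (T (2 * j + 1)) := by
      constructor <;> apply hT <;> (try rw [mem_ofPred_eq]) <;> omega
    obtain ⟨hhat₁, hhat₀⟩ := hhat.2 j hj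
    obtain ⟨hchk₁, hchk₀⟩ := hchk.2 j hj
    rcases Bool.eq_false_or_eq_true (ehat j) with h | h
    · exact not_near_shift_and_near_zero hm hδ (hαhat j hj) hmem (hhat₁ h)
        (hchk₀ (by simpa [h] using hne))
    · exact not_near_shift_and_near_zero hm hδ (hαchk j hj) hmem
        (hchk₁ (by simpa [h] using hne)) (hhat₀ h)
  · rintro τ T hT ehat echk ⟨j, hj, hne⟩ αhat αchk hαhat hαchk x ⟨hhat, hchk⟩
    have hmem : T (2 * j) ∈ Icc (T (2 * j - 1)) (T (2 * j + 1)) := by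
      constructor <;> apply hT <;> (try rw [mem_ofPred_eq]) <;> omega
    obtain ⟨hhat₁, hhat₀⟩ := hhat.2 j hj
    obtain ⟨hchk₁, hchk₀⟩ := hchk.2 j hj
    rcases Bool.eq_false_or_eq_true (ehat j) with h | h
    · exact not_near_shift_and_near_zero hm hδ (hαhat j hj) hmem (hhat₁ h)
        (hchk₀ (by simpa [h] using hne))
    · exact not_near_shift_and_near_zero hm hδ (hαchk j hj) hmem
        (hchk₁ (by simpa [h] using hne)) (hhat₀ h)
end
end

section
/- Lemma 5.1 (hitting a prescribed time window after one loop; conditional form). Given real numbers λs⁺ < 0 < λu⁺ and λs⁻ < 0 < λu⁻ and the derived constants Σfwd, Σ̄, σ̲, K₀, μ₀, ν₀, let 0 < μ ≤ μ₀, ν ≥ ν₀, 0 < ε < 1, τ ∈ ℝ, B ≥ 0, B′ ≥ 0 and Δ ≥ 2K₀(1+ν)|ln ε| + B + B′. Let 𝒯 : (0,1) → ℝ be continuous and satisfy (Σfwd − μ)|ln d| ≤ 𝒯(d) − τ ≤ (Σfwd + μ)|ln d| for all d ∈ (0,1). Then: (i) exp(−5(Δ+B)/(2Σfwd)) < ε^{(1+ν)/σ̲}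 < 1, so the interval I₁ := [exp(−5(Δ+B)/(2Σfwd)), ε^{(1+ν)/σ̲}] is a nonempty compact subinterval of (0,1); (ii) there exist D_a, D_b ∈ I₁ with 𝒯(D_a) = τ + Δ + B and 𝒯(D_b) = τ + Δ − B; consequently the image 𝒯(I₁) contains the whole interval [τ + Δ − B, τ + Δ + B]. -/
open Set

/-- **Lemma 5.1 (hitting a prescribed time window after one loop; conditional form).**
Given the eigenvalue data and the derived constants `Σfwd, Σ̄, σ̲, K₀, μ₀, ν₀`, let
`0 < μ ≤ μ₀`, `ν ≥ ν₀`, `0 < ε < 1`, `B, B' ≥ 0` and `Δ ≥ 2K₀(1+ν)|ln ε| + B + B'`, and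
let `𝒯 : (0,1) → ℝ` be continuous with `(Σfwd−μ)|ln d| ≤ 𝒯(d) − τ ≤ (Σfwd+μ)|ln d|`.
Then `I₁ = [exp(−5(Δ+B)/(2Σfwd)), ε^{(1+ν)/σ̲}]` is a nonempty compact subinterval of
`(0,1)` and there are `D_a, D_b ∈ I₁` with `𝒯(D_a) = τ + Δ + B`, `𝒯(D_b) = τ + Δ − B`;
consequently `𝒯(I₁) ⊇ [τ + Δ − B, τ + Δ + B]`. -/
theorem lemma_5_1_time_window
    (lsp lup lsm lum : ℝ)
    (hlsp : lsp < 0) (hlup : 0 < lup) (hlsm : lsm < 0) (hlum : 0 < lum)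
    (σfp σfm σbm σlow σhigh Sfp Sbm Sf Sb Sh K0 ν0 μ0 : ℝ)
    (hσfp : σfp = |lsp| / (lup + |lsp|))
    (hσfm : σfm = (lum + |lsm|) / lum)
    (hσbm : σbm = 1 / σfm)
    (hσlow : σlow = min σfp σbm)
    (hσhigh : σhigh = max σfp σbm)
    (hSfp : Sfp = 1 / (lup + |lsp|))
    (hSbm : Sbm = 1 / (lum + |lsm|))
    (hSf : Sf = (lum + |lsp|) / (lum * (lup + |lsp|)))
    (hSb : Sb = (lum + |lsp|) / (|lsp| * (lum + |lsm|)))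
    (hSh : Sh = max Sf Sb)
    (hK0 : K0 = 3 * Sh / (2 * σlow))
    (hν0 : ν0 = max (3*σhigh - 1) 1)
    (hμ0 : μ0 = (1/4) * min (min Sfp Sbm) (σlow^2))
    (μ ν ε τ B B' Δ : ℝ)
    (hμpos : 0 < μ) (hμ : μ ≤ μ0) (hν : ν0 ≤ ν)
    (hε0 : 0 < ε) (hε1 : ε < 1) (hB : 0 ≤ B) (hB' : 0 ≤ B')
    (hΔ : 2 * K0 * (1+ν) * |Real.log ε| + B + B' ≤ Δ)
    (𝒯 : ℝ → ℝ) (h𝒯c : ContinuousOn 𝒯 (Ioo 0 1))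
    (h𝒯 : ∀ d ∈ Ioo (0:ℝ) 1,
      (Sf - μ) * |Real.log d| ≤ 𝒯 d - τ ∧ 𝒯 d - τ ≤ (Sf + μ) * |Real.log d|) :
    0 < Real.exp (-(5*(Δ+B)/(2*Sf))) ∧
    Real.exp (-(5*(Δ+B)/(2*Sf))) < ε ^ ((1+ν)/σlow) ∧
    ε ^ ((1+ν)/σlow) < 1 ∧
    (∃ Da ∈ Icc (Real.exp (-(5*(Δ+B)/(2*Sf)))) (ε ^ ((1+ν)/σlow)),
     ∃ Db ∈ Icc (Real.exp (-(5*(Δ+B)/(2*Sf)))) (ε ^ ((1+ν)/σlow)),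
      𝒯 Da = τ + Δ + B ∧ 𝒯 Db = τ + Δ - B) ∧
    Icc (τ + Δ - B) (τ + Δ + B) ⊆
      𝒯 '' Icc (Real.exp (-(5*(Δ+B)/(2*Sf)))) (ε ^ ((1+ν)/σlow)) := by
  have hlsp' : 0 < |lsp| := abs_pos.mpr hlsp.ne
  have hlsm' : 0 < |lsm| := abs_pos.mpr hlsm.ne
  have hσ : 0 < σlow := by
    rw [hσlow, hσbm, hσfm, hσfp]
    exact lt_min (by positivity) (by positivity)
  have hSfp_pos : 0 < Sfp := by rw [hSfp]; positivity
  have hSfp_le : Sfp ≤ Sf := by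
    rw [hSfp, hSf, div_le_div_iff₀ (by positivity) (by positivity)]
    nlinarith [mul_pos hlsp' (add_pos hlup hlsp')]
  have hSf_pos : 0 < Sf := hSfp_pos.trans_le hSfp_le
  have hμSf : μ ≤ Sf / 2 := by
    have : min (min Sfp Sbm) (σlow ^ 2) ≤ Sfp := (min_le_left _ _).trans (min_le_left _ _)
    linarith
  have hν1 : 1 ≤ ν := (le_max_right _ _).trans (hν0 ▸ hν)
  have hL : 0 < |Real.log ε| := abs_pos.mpr (Real.log_neg hε0 hε1).ne
  have hLε : Real.log ε = -|Real.log ε| := by rw [abs_of_neg (Real.log_neg hε0 hε1), neg_neg]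
  obtain ⟨P, hP⟩ : ∃ P, P = (1 + ν) / σlow * |Real.log ε| := ⟨_, rfl⟩
  have hP_pos : 0 < P := by rw [hP]; positivity
  have hΔP : 3 * (Sf * P) + B + B' ≤ Δ := by
    have hK : 2 * K0 * (1 + ν) * |Real.log ε| = 3 * (Sh * P) := by
      rw [hK0, hP]; field_simp
    have hSfSh : Sf * P ≤ Sh * P :=
      mul_le_mul_of_nonneg_right (hSh ▸ le_max_left _ _) hP_pos.le
    linarith
  have hright : ε ^ ((1 + ν) / σlow) = Real.exp (-P) := by
    rw [Real.rpow_def_of_pos hε0, hLε, hP]; congr 1; ring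
  obtain ⟨A, hA⟩ : ∃ A, A = 5 * (Δ + B) / (2 * Sf) := ⟨_, rfl⟩
  have hSfA : Sf * A = 5 / 2 * (Δ + B) := by rw [hA]; field_simp
  have hSfP : 0 < Sf * P := mul_pos hSf_pos hP_pos
  have hPA : P < A := lt_of_mul_lt_mul_left (by linarith) hSf_pos.le
  have hA_pos : 0 < A := hP_pos.trans hPA
  rw [hright, ← hA]
  have hlt : Real.exp (-A) < Real.exp (-P) := Real.exp_lt_exp.mpr (by linarith)
  have hlt1 : Real.exp (-P) < 1 := Real.exp_lt_one_iff.mpr (by linarith)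
  have hsub : Icc (Real.exp (-A)) (Real.exp (-P)) ⊆ Ioo 0 1 := fun x hx =>
    ⟨(Real.exp_pos _).trans_le hx.1, hx.2.trans_lt hlt1⟩
  have hTleft := (h𝒯 _ (hsub (left_mem_Icc.mpr hlt.le))).1
  have hTright := (h𝒯 _ (hsub (right_mem_Icc.mpr hlt.le))).2
  rw [Real.log_exp, abs_neg, abs_of_pos hA_pos] at hTleft
  rw [Real.log_exp, abs_neg, abs_of_pos hP_pos] at hTright
  have hμA : μ * A ≤ Sf / 2 * A := mul_le_mul_of_nonneg_right hμSf hA_pos.le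
  have hμP : μ * P ≤ Sf / 2 * P := mul_le_mul_of_nonneg_right hμSf hP_pos.le
  have himage : Icc (τ + Δ - B) (τ + Δ + B) ⊆
      𝒯 '' Icc (Real.exp (-A)) (Real.exp (-P)) :=
    (Icc_subset_Icc (by linarith) (by linarith)).trans
      (intermediate_value_Icc' hlt.le (h𝒯c.mono hsub))
  obtain ⟨Da, hDa, hTa⟩ := himage (right_mem_Icc.mpr (by linarith))
  obtain ⟨Db, hDb, hTb⟩ := himage (left_mem_Icc.mpr (by linarith))
  exact ⟨Real.exp_pos _, hlt, hlt1, ⟨Da, hDa, Db, hDb, hTa, hTb⟩, himage⟩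
end

section
/- Lemma 4.6, time-separation part (conditional form). Given real numbers λs⁺ < 0 < λu⁺ and λs⁻ < 0 < λu⁻ and the derived constants σfwd, σfwd₊, σbwd₋, Σfwd₊, Σbwd₋, σ̲, μ₀, ν₀, let 0 < μ ≤ μ₀, ν ≥ ν₀, 0 < ε < 1, and set T_a = |ln ε|/λu⁻ and T_b = |ln ε|/|λs⁺|. Then for every 0 < d ≤ ε^{(1+ν)/σ̲}: (i) (Σfwd₊ − μ)·|ln d| ≥ T_b; (ii) for every 0 < D ≤ d^{σfwd−μ} one has (Σbwd₋ − μ)·|ln D| ≥ T_a. Consequently, if times t₀ < t_{1/2} < t₁ satisfy t_{1/2} − t₀ ≥ (Σfwd₊ − μ)|ln d| and t₁ − t_{1/2} ≥ (Σbwd₋ − μ)|ln D| with 0 < D ≤ d^{σfwd−μ}, then t₀ + T_b ≤ t_{1/2} ≤ t₁ − T_a. -/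
open Set

/-- **Lemma 4.6, time-separation part (conditional form).**
Given the eigenvalue data and the derived constants, with `T_a = |ln ε|/λu⁻` and
`T_b = |ln ε|/|λs⁺|`, for every `0 < d ≤ ε^{(1+ν)/σ̲}`:
(i) `(Σfwd₊ − μ)|ln d| ≥ T_b`;
(ii) for every `0 < D ≤ d^{σfwd−μ}` one has `(Σbwd₋ − μ)|ln D| ≥ T_a`;
consequently times `t₀ < t_{1/2} < t₁` with `t_{1/2} − t₀ ≥ (Σfwd₊−μ)|ln d|` and
`t₁ − t_{1/2} ≥ (Σbwd₋−μ)|ln D|` satisfy `t₀ + T_b ≤ t_{1/2} ≤ t₁ − T_a`. -/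
theorem lemma_4_6_time_separation
    (lsp lup lsm lum : ℝ)
    (hlsp : lsp < 0) (hlup : 0 < lup) (hlsm : lsm < 0) (hlum : 0 < lum)
    (σfp σfm σf σbm σlow σhigh Sfp Sbm ν0 μ0 : ℝ)
    (hσfp : σfp = |lsp| / (lup + |lsp|))
    (hσfm : σfm = (lum + |lsm|) / lum)
    (hσf : σf = σfp * σfm)
    (hσbm : σbm = 1 / σfm)
    (hσlow : σlow = min σfp σbm)
    (hσhigh : σhigh = max σfp σbm)
    (hSfp : Sfp = 1 / (lup + |lsp|))
    (hSbm : Sbm = 1 / (lum + |lsm|))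
    (hν0 : ν0 = max (3*σhigh - 1) 1)
    (hμ0 : μ0 = (1/4) * min (min Sfp Sbm) (σlow^2))
    (μ ν ε : ℝ) (hμpos : 0 < μ) (hμ : μ ≤ μ0) (hν : ν0 ≤ ν)
    (hε0 : 0 < ε) (hε1 : ε < 1)
    (Ta Tb : ℝ) (hTa : Ta = |Real.log ε| / lum) (hTb : Tb = |Real.log ε| / |lsp|) :
    ∀ d : ℝ, 0 < d → d ≤ ε ^ ((1+ν)/σlow) →
      (Tb ≤ (Sfp - μ) * |Real.log d|) ∧
      (∀ D : ℝ, 0 < D → D ≤ d ^ (σf - μ) → Ta ≤ (Sbm - μ) * |Real.log D|) ∧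
      (∀ t0 thalf t1 : ℝ, t0 < thalf → thalf < t1 →
        (Sfp - μ) * |Real.log d| ≤ thalf - t0 →
        ∀ D : ℝ, 0 < D → D ≤ d ^ (σf - μ) →
          (Sbm - μ) * |Real.log D| ≤ t1 - thalf →
          t0 + Tb ≤ thalf ∧ thalf ≤ t1 - Ta) := by
  have hp : 0 < |lsp| := abs_pos.mpr hlsp.ne
  have hq : 0 < |lsm| := abs_pos.mpr hlsm.ne
  have hA : 0 < lup + |lsp| := by positivity
  have hB : 0 < lum + |lsm| := by positivity
  have hσbm_div : σbm = lum / (lum + |lsm|) := by rw [hσbm, hσfm, one_div_div]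
  have hσfp_pos : 0 < σfp := by rw [hσfp]; positivity
  have hσbm_pos : 0 < σbm := by rw [hσbm_div]; positivity
  have hσbm_le_one : σbm ≤ 1 := by
    rw [hσbm_div, div_le_one hB]; linarith
  have hσlow_pos : 0 < σlow := by rw [hσlow]; exact lt_min hσfp_pos hσbm_pos
  have hσlow_le_fp : σlow ≤ σfp := hσlow.le.trans (min_le_left _ _)
  have hσlow_le_bm : σlow ≤ σbm := hσlow.le.trans (min_le_right _ _)
  have hSfp_pos : 0 < Sfp := by rw [hSfp]; positivity
  have hSbm_pos : 0 < Sbm := by rw [hSbm]; positivity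
  have hσf_div : σf = σfp / σbm := by rw [hσf, hσbm, div_div_eq_mul_div, div_one]
  have hμ_Sfp : μ ≤ Sfp / 4 := by
    have h := (min_le_left (min Sfp Sbm) (σlow ^ 2)).trans (min_le_left Sfp Sbm)
    linarith
  have hμ_Sbm : μ ≤ Sbm / 4 := by
    have h := (min_le_left (min Sfp Sbm) (σlow ^ 2)).trans (min_le_right Sfp Sbm)
    linarith
  have hμ_σf : μ ≤ σf / 4 := by
    have h := min_le_right (min Sfp Sbm) (σlow ^ 2)
    have h1 : σlow ^ 2 ≤ σfp := by
      rw [sq]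
      exact (mul_le_of_le_one_right hσlow_pos.le
        (hσlow_le_bm.trans hσbm_le_one)).trans hσlow_le_fp
    have h2 : σfp ≤ σf := by
      rw [hσf_div]; exact le_div_self hσfp_pos.le hσbm_pos hσbm_le_one
    linarith
  have hσf_pos : 0 < σf := by rw [hσf_div]; positivity
  have hν1 : 1 ≤ ν := (le_max_right _ _).trans (hν0.symm.le.trans hν)
  have hlogε : Real.log ε < 0 := Real.log_neg hε0 hε1
  have hL : |Real.log ε| = -Real.log ε := abs_of_neg hlogε
  have hL_pos : 0 < |Real.log ε| := abs_pos.mpr hlogε.ne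
  intro d hd hdε
  have hlogd : (1 + ν) / σlow * |Real.log ε| ≤ -Real.log d := by
    have h := Real.log_le_log hd hdε
    rw [Real.log_rpow hε0] at h
    rw [hL]; linarith
  have hX : -Real.log d ≤ |Real.log d| := neg_le_abs _
  have hX_pos : 0 < |Real.log d| :=
    lt_of_lt_of_le (by positivity) (hlogd.trans hX)
  have hXd : |Real.log d| = -Real.log d :=
    abs_of_neg (by
      have : 0 < (1 + ν) / σlow * |Real.log ε| := by positivity
      linarith)
  have hσX : 2 * |Real.log ε| ≤ σfp * |Real.log d| := by
    have h1 : (1 + ν) * |Real.log ε| ≤ σlow * |Real.log d| := by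
      have h := mul_le_mul_of_nonneg_left (hlogd.trans hX) hσlow_pos.le
      rwa [← mul_assoc, mul_div_cancel₀ _ hσlow_pos.ne'] at h
    have h2 : 2 * |Real.log ε| ≤ (1 + ν) * |Real.log ε| :=
      mul_le_mul_of_nonneg_right (by linarith) hL_pos.le
    exact h2.trans (h1.trans (mul_le_mul_of_nonneg_right hσlow_le_fp hX_pos.le))
  have hfwd : Tb ≤ (Sfp - μ) * |Real.log d| := by
    have h1 : σfp = Sfp * |lsp| := by rw [hσfp, hSfp]; ring
    rw [h1] at hσX
    rw [hTb, div_le_iff₀ hp]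
    have h2 : 3 / 4 * Sfp * (|Real.log d| * |lsp|) ≤ (Sfp - μ) * (|Real.log d| * |lsp|) :=
      mul_le_mul_of_nonneg_right (by linarith) (by positivity)
    linarith
  have hbwd : ∀ D : ℝ, 0 < D → D ≤ d ^ (σf - μ) → Ta ≤ (Sbm - μ) * |Real.log D| := by
    intro D hD hDd
    have hlogD : (σf - μ) * |Real.log d| ≤ |Real.log D| := by
      have h := Real.log_le_log hD hDd
      rw [Real.log_rpow hd] at h
      have h2 := neg_le_abs (Real.log D)
      rw [hXd]; linarith
    have h1 : σbm = Sbm * lum := by rw [hσbm_div, hSbm]; ring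
    have h2 : σf * σbm = σfp := by rw [hσf_div, div_mul_cancel₀ _ hσbm_pos.ne']
    have h3 : 3 / 4 * σf * |Real.log d| ≤ |Real.log D| :=
      (mul_le_mul_of_nonneg_right (by linarith) hX_pos.le).trans hlogD
    have h4 : 3 / 2 * |Real.log ε| ≤ σbm * |Real.log D| := by
      have h := mul_le_mul_of_nonneg_left h3 hσbm_pos.le
      rw [← h2] at hσX
      linarith
    rw [h1] at h4
    rw [hTa, div_le_iff₀ hlum]
    have h5 : 3 / 4 * Sbm * (|Real.log D| * lum) ≤ (Sbm - μ) * (|Real.log D| * lum) :=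
      mul_le_mul_of_nonneg_right (by linarith) (by positivity)
    linarith
  refine ⟨hfwd, hbwd, fun t0 thalf t1 _ _ h01 D hD hDd h12 => ?_⟩
  have h := hbwd D hD hDd
  constructor <;> linarith
end

section
/- Key exponent inequality (from the proof of Lemma 5.14). For any real numbers λs⁺ < 0 < λu⁺ and λs⁻ < 0 < λu⁻, the constants defined from them satisfy ((1+ν₀)/σ̲)·(σfwd − μ₀) ≥ 9/4; equivalently, the exponent ν̄ := ((1+ν₀)/σ̲)·(σfwd − μ₀) − 2 satisfies ν̄ ≥ 1/4 > 0. -/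
/-- If `0 < l ≤ h ≤ 1`, `l ≤ s * h`, `3 * h ≤ 1 + ν` and `μ ≤ l ^ 2 / 4`,
then `(1 + ν) / l * (s - μ) ≥ 9 / 4`. -/
lemma nine_fourths_le_div_mul_sub {l h s ν μ : ℝ} (hl : 0 < l) (hlh : l ≤ h) (hh : h ≤ 1)
    (hs : l ≤ s * h) (hν : 3 * h ≤ 1 + ν) (hμ : μ ≤ 1 / 4 * l ^ 2) :
    9 / 4 ≤ (1 + ν) / l * (s - μ) := by
  have hpos : 0 < h := hl.trans_le hlh
  have hlow : 3 / 4 * l ≤ (s - μ) * h := by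
    have h1 : μ * h ≤ 1 / 4 * l ^ 2 * h := mul_le_mul_of_nonneg_right hμ hpos.le
    have h2 : l * h ≤ 1 := mul_le_one₀ (hlh.trans hh) hpos.le hh
    nlinarith [mul_le_mul_of_nonneg_left h2 hl.le]
  have hsμ : 0 ≤ s - μ := by
    by_contra! hneg
    nlinarith [mul_neg_of_neg_of_pos hneg hpos]
  rw [div_mul_eq_mul_div, le_div_iff₀ hl]
  nlinarith [mul_le_mul_of_nonneg_right hν hsμ]


/-- **Key exponent inequality (from the proof of Lemma 5.14).**
For any eigenvalue data `λs± < 0 < λu±`, the derived constants satisfy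
`((1+ν₀)/σ̲)(σfwd − μ₀) ≥ 9/4`; equivalently `ν̄ = ((1+ν₀)/σ̲)(σfwd − μ₀) − 2 ≥ 1/4 > 0`. -/
theorem key_exponent_inequality
    (lsp lup lsm lum : ℝ)
    (hlsp : lsp < 0) (hlup : 0 < lup) (hlsm : lsm < 0) (hlum : 0 < lum)
    (σfp σfm σf σbm σlow σhigh Sfp Sbm ν0 μ0 : ℝ)
    (hσfp : σfp = |lsp| / (lup + |lsp|))
    (hσfm : σfm = (lum + |lsm|) / lum)
    (hσf : σf = σfp * σfm)
    (hσbm : σbm = 1 / σfm)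
    (hσlow : σlow = min σfp σbm)
    (hσhigh : σhigh = max σfp σbm)
    (hSfp : Sfp = 1 / (lup + |lsp|))
    (hSbm : Sbm = 1 / (lum + |lsm|))
    (hν0 : ν0 = max (3*σhigh - 1) 1)
    (hμ0 : μ0 = (1/4) * min (min Sfp Sbm) (σlow^2)) :
    9/4 ≤ ((1+ν0)/σlow) * (σf - μ0) ∧
    1/4 ≤ ((1+ν0)/σlow) * (σf - μ0) - 2 := by
  have hp : 0 < |lsp| := abs_pos.mpr hlsp.ne
  have hm : 0 < |lsm| := abs_pos.mpr hlsm.ne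
  have ha : 0 < σfp := by rw [hσfp]; positivity
  have ha1 : σfp ≤ 1 := by
    rw [hσfp, div_le_one (by positivity)]
    linarith
  have hfm : 1 ≤ σfm := by
    rw [hσfm, one_le_div hlum]
    linarith
  have hfm0 : 0 < σfm := one_pos.trans_le hfm
  have hb : 0 < σbm := by rw [hσbm]; positivity
  have hb1 : σbm ≤ 1 := by
    rw [hσbm, div_le_one hfm0]
    exact hfm
  have hmul : σfm * σbm = 1 := by
    rw [hσbm]
    exact mul_one_div_cancel hfm0.ne'
  have hl : 0 < σlow := hσlow ▸ lt_min ha hb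
  have hs : σlow ≤ σf * σhigh := by
    calc σlow ≤ σfp := hσlow ▸ min_le_left _ _
      _ = σf * σbm := by rw [hσf, mul_assoc, hmul, mul_one]
      _ ≤ σf * σhigh :=
        mul_le_mul_of_nonneg_left (hσhigh ▸ le_max_right _ _) (hσf ▸ (mul_pos ha hfm0).le)
  have hν : 3 * σhigh ≤ 1 + ν0 := by
    linarith [le_max_left (3 * σhigh - 1) 1]
  have hμ : μ0 ≤ 1 / 4 * σlow ^ 2 := by
    linarith [min_le_right (min Sfp Sbm) (σlow ^ 2)]
  have key : 9 / 4 ≤ (1 + ν0) / σlow * (σf - μ0) :=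
    nine_fourths_le_div_mul_sub hl (hσlow ▸ hσhigh ▸ min_le_max)
      (hσhigh ▸ max_le ha1 hb1) hs hν hμ
  exact ⟨key, by linarith⟩
end
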